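/- arXiv:2301.13721 — 3 statements merged into one kernel-verified Lean document; each statement's English description precedes it below -/
import Mathlib

section
/- For any strictly positive joint distribution p on C × K, the plug-in estimator is an upper bound of the mutual information: I_est(p) ≥ I(p). -/
open Finset

/-- Marginal on the first coordinate: `p_C(c) = ∑ₖ p(c,k)`. -/
noncomputable def margC {C K : Type*} [Fintype K] (p : C × K → ℝ) (c : C) : ℝ :=
  ∑ k, p (c, k)

/-- Marginal on the second coordinate: `p_K(k) = ∑_c p(c,k)`. -/
noncomputable def margK {C K : Type*} [Fintype C] (p : C × K → ℝ) (k : K) : ℝ :=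
  ∑ c, p (c, k)

/-- Conditional distribution: `p(k|c) = p(c,k) / p_C(c)`. -/
noncomputable def condK {C K : Type*} [Fintype K] (p : C × K → ℝ) (c : C) (k : K) : ℝ :=
  p (c, k) / margC p c

/-- Mutual information `I(p) = ∑_{(c,k)} p(c,k) log (p(c,k) / (p_C(c) p_K(k)))`. -/
noncomputable def mutInfo {C K : Type*} [Fintype C] [Fintype K] (p : C × K → ℝ) : ℝ :=
  ∑ ck : C × K, p ck * Real.log (p ck / (margC p ck.1 * margK p ck.2))

/-- The plug-in estimator
`I_est(p) = ∑ p(c,k) log p(k|c) − ∑ p_C(c) p_K(k) log p(k|c)`. -/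
noncomputable def Iest {C K : Type*} [Fintype C] [Fintype K] (p : C × K → ℝ) : ℝ :=
  (∑ ck : C × K, p ck * Real.log (condK p ck.1 ck.2)) -
    ∑ ck : C × K, margC p ck.1 * margK p ck.2 * Real.log (condK p ck.1 ck.2)

/-- The variational estimator, for `q (c,k) = q(k|c)` a conditional distribution:
`I_θ(p,q) = ∑ p(c,k) log q(k|c) − ∑ p_C(c) p_K(k) log q(k|c)`. -/
noncomputable def Itheta {C K : Type*} [Fintype C] [Fintype K] (p q : C × K → ℝ) : ℝ :=
  (∑ ck : C × K, p ck * Real.log (q ck)) -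
    ∑ ck : C × K, margC p ck.1 * margK p ck.2 * Real.log (q ck)

/-- Kullback–Leibler divergence of finitely supported positive distributions. -/
noncomputable def KLdiv {A : Type*} [Fintype A] (r s : A → ℝ) : ℝ :=
  ∑ a, r a * Real.log (r a / s a)

theorem sum_margC {C K : Type*} [Fintype C] [Fintype K] (p : C × K → ℝ) :
    ∑ c, margC p c = ∑ ck, p ck :=
  (Fintype.sum_prod_type p).symm

/-- The joint distribution and the product of its marginals give the same expectation to a
function of the second coordinate. -/
theorem sum_margC_mul_margK_mul {C K : Type*} [Fintype C] [Fintype K] (p : C × K → ℝ)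
    (hsum : ∑ ck : C × K, p ck = 1) (f : K → ℝ) :
    ∑ ck : C × K, margC p ck.1 * margK p ck.2 * f ck.2 = ∑ ck : C × K, p ck * f ck.2 := by
  have hprod : ∑ ck : C × K, margC p ck.1 * margK p ck.2 * f ck.2 =
      (∑ c, margC p c) * ∑ k, margK p k * f k := by
    simp only [Fintype.sum_prod_type, mul_assoc, Finset.sum_mul_sum]
  rw [hprod, sum_margC, hsum, one_mul, Fintype.sum_prod_type_right]
  simp only [margK, Finset.sum_mul]

/-- Pointwise form of the Gibbs inequality. -/
theorem mul_log_div_le_sub {a b : ℝ} (ha : 0 < a) (hb : 0 < b) :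
    b * Real.log (a / b) ≤ a - b := by
  have h := mul_le_mul_of_nonneg_left (Real.log_le_sub_one_of_pos (div_pos ha hb)) hb.le
  rwa [mul_sub, mul_one, mul_div_cancel₀ _ hb.ne'] at h

/-- **Proposition 1.1 (discrete form).** For any strictly positive joint distribution `p`
on `C × K`, the plug-in estimator is an upper bound on the mutual information. -/
theorem Iest_ge_mutInfo {C K : Type*} [Fintype C] [Fintype K] [Nonempty C] [Nonempty K]
    (p : C × K → ℝ) (hpos : ∀ ck, 0 < p ck) (hsum : ∑ ck : C × K, p ck = 1) :
    Iest p ≥ mutInfo p := by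
  have hC (c : C) : 0 < margC p c :=
    Finset.sum_pos (fun k _ => hpos (c, k)) Finset.univ_nonempty
  have hK (k : K) : 0 < margK p k :=
    Finset.sum_pos (fun c _ => hpos (c, k)) Finset.univ_nonempty
  have hlog (ck : C × K) : Real.log (p ck / (margC p ck.1 * margK p ck.2)) =
      Real.log (condK p ck.1 ck.2) - Real.log (margK p ck.2) := by
    rw [← div_div]
    exact Real.log_div (div_pos (hpos ck) (hC ck.1)).ne' (hK ck.2).ne'
  have hgibbs : ∑ ck : C × K, margC p ck.1 * margK p ck.2 *
      (Real.log (condK p ck.1 ck.2) - Real.log (margK p ck.2)) ≤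
      ∑ ck : C × K, (p ck - margC p ck.1 * margK p ck.2) := by
    refine Finset.sum_le_sum fun ck _ => ?_
    rw [← hlog]
    exact mul_log_div_le_sub (hpos ck) (mul_pos (hC ck.1) (hK ck.2))
  have hmass := sum_margC_mul_margK_mul p hsum fun _ => 1
  have hexp := sum_margC_mul_margK_mul p hsum fun k => Real.log (margK p k)
  simp only [mul_one] at hmass
  simp only [mul_sub, Finset.sum_sub_distrib] at hgibbs
  simp only [Iest, mutInfo, hlog, mul_sub, Finset.sum_sub_distrib]
  linarith
end

section
/- For any strictly positive joint distribution p on C × K and any strictly positive conditional distribution q from C to K, the variational estimator satisfies the identity I_θ(p,q) − I(p) = KL(p_C ⊗ p_K ‖ q̃) − KL(p ‖ q̃), where p_C ⊗ p_K denotes the product distribution (c,k) ↦ p_C(c)·p_K(k). -/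
open Finset

theorem margC_pos {C K : Type*} [Fintype K] [Nonempty K] {p : C × K → ℝ}
    (hpos : ∀ ck, 0 < p ck) (c : C) : 0 < margC p c :=
  Finset.sum_pos (fun k _ => hpos (c, k)) Finset.univ_nonempty

theorem margK_pos {C K : Type*} [Fintype C] [Nonempty C] {p : C × K → ℝ}
    (hpos : ∀ ck, 0 < p ck) (k : K) : 0 < margK p k :=
  Finset.sum_pos (fun c _ => hpos (c, k)) Finset.univ_nonempty

/-- A function of the second coordinate has the same expectation under `p` as under the product
of the marginals of `p`. -/
theorem sum_mul_snd_eq_sum_marg_mul_snd {C K : Type*} [Fintype C] [Fintype K] {p : C × K → ℝ}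
    (hsum : ∑ ck : C × K, p ck = 1) (f : K → ℝ) :
    ∑ ck : C × K, p ck * f ck.2 = ∑ ck : C × K, margC p ck.1 * margK p ck.2 * f ck.2 := by
  have hC : ∑ c, margC p c = 1 := by rw [← hsum, Fintype.sum_prod_type]; rfl
  calc ∑ ck : C × K, p ck * f ck.2 = ∑ k, margK p k * f k := by
        simp only [Fintype.sum_prod_type_right, margK, Finset.sum_mul]
    _ = ∑ ck : C × K, margC p ck.1 * margK p ck.2 * f ck.2 := by
        simp only [Fintype.sum_prod_type_right, mul_assoc, ← Finset.sum_mul, hC, one_mul]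

/-- **Key identity in the proof of Proposition 1.3 (discrete form).**
`I_θ(p,q) − I(p) = KL(p_C ⊗ p_K ‖ q̃) − KL(p ‖ q̃)` where `q̃(c,k) = p_C(c) q(k|c)`. -/
theorem Itheta_sub_mutInfo_eq {C K : Type*} [Fintype C] [Fintype K] [Nonempty C] [Nonempty K]
    (p q : C × K → ℝ) (hpos : ∀ ck, 0 < p ck) (hsum : ∑ ck : C × K, p ck = 1)
    (hqpos : ∀ ck, 0 < q ck) (hqsum : ∀ c, ∑ k, q (c, k) = 1) :
    Itheta p q - mutInfo p =
      KLdiv (fun ck : C × K => margC p ck.1 * margK p ck.2)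
          (fun ck : C × K => margC p ck.1 * q ck) -
        KLdiv p (fun ck : C × K => margC p ck.1 * q ck) := by
  have hmarg := sum_mul_snd_eq_sum_marg_mul_snd hsum (fun k => Real.log (margK p k))
  rw [← sub_eq_zero] at hmarg ⊢
  rw [← hmarg]
  simp only [Itheta, mutInfo, KLdiv, ← Finset.sum_sub_distrib]
  refine Finset.sum_congr rfl fun ck _ => ?_
  have hp := (hpos ck).ne'
  have hq := (hqpos ck).ne'
  have hC := (margC_pos hpos ck.1).ne'
  have hK := (margK_pos hpos ck.2).ne'
  rw [Real.log_div hp (mul_ne_zero hC hK), Real.log_div (mul_ne_zero hC hK) (mul_ne_zero hC hq),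
    Real.log_div hp (mul_ne_zero hC hq), Real.log_mul hC hK, Real.log_mul hC hq]
  ring
end

section
/- For any strictly positive joint distribution p on C × K, any strictly positive conditional distribution q from C to K, and any ε ≥ 0, if the averaged conditional divergence ∑_c p_C(c)·KL(p(·|c) ‖ q(·|c)) is at most ε, then either I_θ(p,q) ≥ I(p) or |I_θ(p,q) − I(p)| ≤ ε. -/
open Finset

/-- The Gibbs inequality on a finite type. -/
theorem KLdiv_nonneg {A : Type*} [Fintype A] {r s : A → ℝ} (hr : ∀ a, 0 < r a)
    (hs : ∀ a, 0 < s a) (h : ∑ a, s a ≤ ∑ a, r a) : 0 ≤ KLdiv r s := by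
  have hle : ∑ a, (r a - s a) ≤ KLdiv r s := by
    refine Finset.sum_le_sum fun a _ => ?_
    have h1 := mul_le_mul_of_nonneg_left
      (Real.one_sub_inv_le_log_of_pos (div_pos (hr a) (hs a))) (hr a).le
    have h2 : r a * (1 - (r a / s a)⁻¹) = r a - s a := by
      have := (hr a).ne'
      have := (hs a).ne'
      field_simp
    linarith
  rw [Finset.sum_sub_distrib] at hle
  linarith

theorem sum_margK {C K : Type*} [Fintype C] [Fintype K] (p : C × K → ℝ) :
    ∑ k, margK p k = ∑ ck, p ck :=
  (Fintype.sum_prod_type_right p).symm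

/-- The estimation error is the difference of the averaged divergences of the marginal on `K`
and of the true conditional from `q`. -/
theorem Itheta_sub_mutInfo {C K : Type*} [Fintype C] [Fintype K] [Nonempty C] [Nonempty K]
    {p q : C × K → ℝ} (hpos : ∀ ck, 0 < p ck) (hsum : ∑ ck : C × K, p ck = 1)
    (hqpos : ∀ ck, 0 < q ck) :
    Itheta p q - mutInfo p =
      ∑ c, margC p c * KLdiv (margK p) (fun k => q (c, k)) -
        ∑ c, margC p c * KLdiv (fun k => condK p c k) (fun k => q (c, k)) := by
  have hcancel :
      ∑ c, ∑ k, (p (c, k) - margC p c * margK p k) * Real.log (margK p k) = 0 := by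
    rw [Finset.sum_comm]
    refine Finset.sum_eq_zero fun k _ => ?_
    rw [← Finset.sum_mul, Finset.sum_sub_distrib, ← Finset.sum_mul, sum_margC, hsum, one_mul]
    simp [margK]
  rw [← sub_eq_zero, ← hcancel]
  simp only [Itheta, mutInfo, KLdiv, Fintype.sum_prod_type, Finset.mul_sum,
    ← Finset.sum_sub_distrib]
  refine Finset.sum_congr rfl fun c _ => Finset.sum_congr rfl fun k _ => ?_
  have hp := (hpos (c, k)).ne'
  have hq := (hqpos (c, k)).ne'
  have hC := (margC_pos hpos c).ne'
  have hK := (margK_pos hpos k).ne'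
  have hcond : margC p c * condK p c k = p (c, k) := mul_div_cancel₀ _ hC
  rw [← mul_assoc (margC p c) (condK p c k), hcond, condK, Real.log_div hp (mul_ne_zero hC hK),
    Real.log_mul hC hK, Real.log_div hK hq, Real.log_div (div_ne_zero hp hC) hq,
    Real.log_div hp hC]
  ring

/-- **Proposition 1.4 (discrete form).** If the averaged conditional KL divergence is at most
`ε`, then either `I_θ(p,q) ≥ I(p)` or `|I_θ(p,q) − I(p)| ≤ ε`. -/
theorem Itheta_ge_or_close {C K : Type*} [Fintype C] [Fintype K] [Nonempty C] [Nonempty K]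
    (p q : C × K → ℝ) (hpos : ∀ ck, 0 < p ck) (hsum : ∑ ck : C × K, p ck = 1)
    (hqpos : ∀ ck, 0 < q ck) (hqsum : ∀ c, ∑ k, q (c, k) = 1)
    (ε : ℝ) (hε : 0 ≤ ε)
    (hKL : ∑ c, margC p c * KLdiv (fun k => condK p c k) (fun k => q (c, k)) ≤ ε) :
    Itheta p q ≥ mutInfo p ∨ |Itheta p q - mutInfo p| ≤ ε := by
  have hnonneg : 0 ≤ ∑ c, margC p c * KLdiv (margK p) (fun k => q (c, k)) :=
    Finset.sum_nonneg fun c _ => mul_nonneg (margC_pos hpos c).le <|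
      KLdiv_nonneg (margK_pos hpos) (fun k => hqpos (c, k))
        (by rw [hqsum, sum_margK, hsum])
  have herr := Itheta_sub_mutInfo hpos hsum hqpos
  rcases le_total (mutInfo p) (Itheta p q) with h | h
  · exact Or.inl h
  · exact Or.inr (abs_le.2 ⟨by linarith, by linarith⟩)
end
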